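/- Let n ≥ 2 and s ∈ (0,1). For every measurable set E ⊂ ℝⁿ of finite measure one has V_s(E) ≤ V_s(E*) = (n ω_n^{s/n}/(n−s)) |E|^{(n−s)/n}, where E* is the open ball centered at the origin with |E*| = |E| and ω_n = |B₁|; moreover equality V_s(E) = V_s(E*) holds only if E is (equivalent to) a ball. In particular, V_s(B_r) = (n ω_n/(n−s)) r^{n−s} for every ball of radius r. -/

import Mathlib

open MeasureTheory Metric Set Filter
open scoped ENNReal NNReal symmDiff Topology

noncomputable section

/-- The ambient Euclidean space `ℝⁿ`. -/
abbrev Rn (n : ℕ) := EuclideanSpace ℝ (Fin n)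

/-- The fractional `s`-perimeter `P_s(E) = ∫_E ∫_{Eᶜ} |x-y|^{-(n+s)} dx dy`. -/
def fracPer (n : ℕ) (s : ℝ) (E : Set (Rn n)) : ℝ≥0∞ :=
  ∫⁻ x in E, ∫⁻ y in Eᶜ, ENNReal.ofReal (‖x - y‖ ^ (-((n : ℝ) + s)))

/-- The Riesz-type potential `∫_E |x-y|^{-s} dx` of `E` evaluated at `y`. -/
def rieszAt (n : ℕ) (s : ℝ) (E : Set (Rn n)) (y : Rn n) : ℝ≥0∞ :=
  ∫⁻ x in E, ENNReal.ofReal (‖x - y‖ ^ (-s))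

/-- `V_s(E) = max_{y ∈ ℝⁿ} ∫_E |x-y|^{-s} dx`. -/
def Vs (n : ℕ) (s : ℝ) (E : Set (Rn n)) : ℝ≥0∞ := ⨆ y : Rn n, rieszAt n s E y

/-- `ω_n`, the volume of the unit ball of `ℝⁿ`. -/
def unitBallVol (n : ℕ) : ℝ := (volume (ball (0 : Rn n) 1)).toReal

/-- The radius `r` such that `|B_r| = |E|`. -/
def ballRad (n : ℕ) (E : Set (Rn n)) : ℝ :=
  ((volume E).toReal / unitBallVol n) ^ ((1 : ℝ) / n)

/-- The fractional isoperimetric deficit `δ_s(E) = (P_s(E) - P_s(B_r))/P_s(B_r)`,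
where `|B_r| = |E|`. -/
def fracDeficit (n : ℕ) (s : ℝ) (E : Set (Rn n)) : ℝ :=
  ((fracPer n s E).toReal - (fracPer n s (ball (0 : Rn n) (ballRad n E))).toReal) /
    (fracPer n s (ball (0 : Rn n) (ballRad n E))).toReal

/-- The normalization constant `c_{n,s} = P_s(B₁)(n-s)/(n ω_n)`. -/
def cns (n : ℕ) (s : ℝ) : ℝ :=
  (fracPer n s (ball (0 : Rn n) 1)).toReal * ((n : ℝ) - s) / (n * unitBallVol n)

/-- The strong asymmetry index
`A_s(E) = min_y { |E Δ B_r(y)|/|B_r| + ((P_s(E) - c_{n,s} ∫_E |x-y|^{-s} dx)/P_s(B_r))^{1/2} }`,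
with `|B_r| = |E|`. -/
def asymA (n : ℕ) (s : ℝ) (E : Set (Rn n)) : ℝ :=
  ⨅ y : Rn n,
    ((volume (E ∆ ball y (ballRad n E))).toReal /
        (volume (ball (0 : Rn n) (ballRad n E))).toReal +
      Real.sqrt (((fracPer n s E).toReal - cns n s * (rieszAt n s E y).toReal) /
        (fracPer n s (ball (0 : Rn n) (ballRad n E))).toReal))

/-- The oscillation index `β_s(E) = ((P_s(E) - c_{n,s} V_s(E))/P_s(B_r))^{1/2}`,
with `|B_r| = |E|`. -/
def betaS (n : ℕ) (s : ℝ) (E : Set (Rn n)) : ℝ :=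
  Real.sqrt (((fracPer n s E).toReal - cns n s * (Vs n s E).toReal) /
    (fracPer n s (ball (0 : Rn n) (ballRad n E))).toReal)

/-- The asymmetry index `ζ_s(E) = (V_s(B_r) - V_s(E))/V_s(B_r)`, with `|B_r| = |E|`. -/
def zetaS (n : ℕ) (s : ℝ) (E : Set (Rn n)) : ℝ :=
  ((Vs n s (ball (0 : Rn n) (ballRad n E))).toReal - (Vs n s E).toReal) /
    (Vs n s (ball (0 : Rn n) (ballRad n E))).toReal

/-- The Fraenkel asymmetry `α(E) = min_y |E Δ B_r(y)|/|B_r|`, with `|B_r| = |E|`. -/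
def fraenkel (n : ℕ) (E : Set (Rn n)) : ℝ :=
  ⨅ y : Rn n, (volume (E ∆ ball y (ballRad n E))).toReal /
    (volume (ball (0 : Rn n) (ballRad n E))).toReal

/-- The fractional Cheeger constant `h_{m,s}(Ω) = inf { P_s(E)/|E|^m : E ⊆ Ω }`. -/
def cheeger (n : ℕ) (m s : ℝ) (Ω : Set (Rn n)) : ℝ :=
  sInf {x : ℝ | ∃ E : Set (Rn n), E ⊆ Ω ∧ MeasurableSet E ∧ 0 < volume E ∧
    x = (fracPer n s E).toReal / (volume E).toReal ^ m}

/-- The energy functional `E_s(E) = P_s(E) + ε V_s(E)`. -/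
def energy (n : ℕ) (s ε : ℝ) (E : Set (Rn n)) : ℝ≥0∞ :=
  fracPer n s E + ENNReal.ofReal ε * Vs n s E

/-- The generalized energy functional `Ẽ_s({E^k}) = Σ_k E_s(E^k)`. -/
def genEnergy (n : ℕ) (s ε : ℝ) (F : ℕ → Set (Rn n)) : ℝ≥0∞ :=
  ∑' k : ℕ, energy n s ε (F k)

/-- Absolute difference in `ℝ≥0∞` (equal to `|a - b|` for finite values). -/
def ennAbsDiff (a b : ℝ≥0∞) : ℝ≥0∞ := (a - b) + (b - a)

/-- The penalized generalized functional `Ẽ_{s,Λ}({E^k}) = Ẽ_s({E^k}) + Λ |Σ_k |E^k| - ω_n|`. -/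
def penEnergy (n : ℕ) (s ε Λ : ℝ) (F : ℕ → Set (Rn n)) : ℝ≥0∞ :=
  genEnergy n s ε F +
    ENNReal.ofReal Λ * ennAbsDiff (∑' k : ℕ, volume (F k)) (volume (ball (0 : Rn n) 1))

/-- `E` is a minimizer of `min { P_s(E) + ε V_s(E) : E ⊆ ℝⁿ measurable, |E| = ω_n }`. -/
def IsEnergyMin (n : ℕ) (s ε : ℝ) (E : Set (Rn n)) : Prop :=
  MeasurableSet E ∧ volume E = volume (ball (0 : Rn n) 1) ∧
    ∀ F : Set (Rn n), MeasurableSet F → volume F = volume (ball (0 : Rn n) 1) →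
      energy n s ε E ≤ energy n s ε F

lemma unitBallVol_pos (n : ℕ) : 0 < unitBallVol n :=
  ENNReal.toReal_pos (measure_ball_pos volume _ one_pos).ne' measure_ball_lt_top.ne

lemma volume_ball_eq {n : ℕ} (hn : n ≠ 0) (y : Rn n) {r : ℝ} (hr : 0 ≤ r) :
    volume (ball y r) = ENNReal.ofReal (r ^ n * unitBallVol n) := by
  have : NeZero n := ⟨hn⟩
  rw [Measure.addHaar_ball _ _ hr, ENNReal.ofReal_mul (by positivity), finrank_euclideanSpace_fin,
    unitBallVol, ENNReal.ofReal_toReal measure_ball_lt_top.ne]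

lemma ballRad_nonneg (n : ℕ) (E : Set (Rn n)) : 0 ≤ ballRad n E :=
  Real.rpow_nonneg (div_nonneg ENNReal.toReal_nonneg (unitBallVol_pos n).le) _

lemma volume_ball_ballRad {n : ℕ} (hn : n ≠ 0) {E : Set (Rn n)} (hE : volume E ≠ ⊤) (y : Rn n) :
    volume (ball y (ballRad n E)) = volume E := by
  have h := unitBallVol_pos n
  rw [volume_ball_eq hn y (ballRad_nonneg n E), ballRad, one_div,
    Real.rpow_inv_natCast_pow (by positivity) hn, div_mul_cancel₀ _ h.ne',
    ENNReal.ofReal_toReal hE]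

/-- The integral of `|x|^{-s}` over a centered ball. -/
lemma rieszAt_ball_self {n : ℕ} (hn : n ≠ 0) {s : ℝ} (hs : s < n) (y : Rn n) {r : ℝ}
    (hr : 0 ≤ r) :
    rieszAt n s (ball y r) y =
      ENNReal.ofReal ((n * unitBallVol n / ((n : ℝ) - s)) * r ^ ((n : ℝ) - s)) := by
  have : NeZero n := ⟨hn⟩
  have hradial : EqOn (fun t : ℝ => t ^ (n - 1) • t ^ (-s)) (fun t => t ^ ((n : ℝ) - s - 1))
      (Ioo 0 r) := by
    intro t ht
    change t ^ (n - 1) * t ^ (-s) = _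
    rw [← Real.rpow_natCast, ← Real.rpow_add ht.1, Nat.cast_pred (Nat.pos_of_ne_zero hn)]
    ring_nf
  have hexp : -1 < (n : ℝ) - s - 1 := by linarith
  have hint : IntegrableOn (fun x : Rn n => ‖x‖ ^ (-s)) (ball 0 r) := by
    refine (integrableOn_fun_norm_addHaar volume (f := fun t : ℝ => t ^ (-s))).2 ?_
    rw [finrank_euclideanSpace_fin, integrableOn_congr_fun hradial measurableSet_Ioo]
    exact ((intervalIntegrable_iff_integrableOn_Ioc_of_le hr).1
      (intervalIntegral.intervalIntegrable_rpow' hexp)).mono_set Ioo_subset_Ioc_self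
  have hval : ∫ x in ball (0 : Rn n) r, ‖x‖ ^ (-s) =
      (n * unitBallVol n / ((n : ℝ) - s)) * r ^ ((n : ℝ) - s) := by
    have h1 : ∀ x : Rn n, (ball (0 : Rn n) r).indicator (fun x => ‖x‖ ^ (-s)) x =
        (Iio r).indicator (fun t : ℝ => t ^ (-s)) ‖x‖ := by
      intro x
      simp [indicator]
    have h2 : ∀ t : ℝ, t ^ (n - 1) • (Iio r).indicator (fun t : ℝ => t ^ (-s)) t =
        (Iio r).indicator (fun t : ℝ => t ^ (n - 1) • t ^ (-s)) t := by
      intro t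
      simp [indicator]
    rw [← integral_indicator measurableSet_ball]
    simp_rw [h1]
    rw [integral_fun_norm_addHaar volume, finrank_euclideanSpace_fin]
    simp_rw [h2]
    rw [setIntegral_indicator measurableSet_Iio, Ioi_inter_Iio,
      setIntegral_congr_fun measurableSet_Ioo hradial, ← integral_Ioc_eq_integral_Ioo,
      ← intervalIntegral.integral_of_le hr, integral_rpow (Or.inl hexp), sub_add_cancel,
      Real.zero_rpow (by linarith)]
    simp only [nsmul_eq_mul, smul_eq_mul, sub_zero, unitBallVol, Measure.real]
    ring
  have htrans : rieszAt n s (ball y r) y =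
      ∫⁻ x in ball (0 : Rn n) r, ENNReal.ofReal (‖x‖ ^ (-s)) := by
    rw [rieszAt, ← lintegral_indicator measurableSet_ball, ← lintegral_indicator measurableSet_ball,
      ← lintegral_sub_right_eq_self (indicator (ball 0 r) _) y]
    congr 1 with x
    simp [indicator, dist_eq_norm]
  rw [htrans, ← hval, ofReal_integral_eq_lintegral_ofReal hint]
  exact .of_forall fun x => by positivity

/-- A set with the volume of a ball loses potential in proportion to its volume outside a larger
concentric ball. -/
lemma rieszAt_add_mul_volume_diff_le {n : ℕ} (hn : n ≠ 0) {s : ℝ} (hs : 0 < s) {E : Set (Rn n)}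
    (hE : MeasurableSet E) {y : Rn n} {r R : ℝ} (hr : 0 < r) (hrR : r ≤ R)
    (hvol : volume (ball y r) = volume E) :
    rieszAt n s E y + ENNReal.ofReal (r ^ (-s) - R ^ (-s)) * volume (E \ ball y R) ≤
      rieszAt n s (ball y r) y := by
  have : NeZero n := ⟨hn⟩
  set f : Rn n → ℝ≥0∞ := fun x => ENNReal.ofReal (‖x - y‖ ^ (-s)) with hf
  have hfm : Measurable f := by fun_prop
  set a := ENNReal.ofReal (r ^ (-s)) with ha
  set d := ENNReal.ofReal (r ^ (-s) - R ^ (-s)) with hd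
  have hB : MeasurableSet (ball y r) := measurableSet_ball
  have hdiff : volume (E \ ball y r) = volume (ball y r \ E) :=
    measure_sdiff_symm hE.nullMeasurableSet hB.nullMeasurableSet hvol.symm
      (measure_ne_top_of_subset inter_subset_right measure_ball_lt_top.ne)
  have houter : (∫⁻ x in E \ ball y r, f x) + d * volume (E \ ball y R) ≤
      a * volume (E \ ball y r) := by
    have hind : d * volume (E \ ball y R) =
        ∫⁻ x in E \ ball y r, (ball y R)ᶜ.indicator (fun _ => d) x := by
      rw [lintegral_indicator_const measurableSet_ball.compl,
        Measure.restrict_apply measurableSet_ball.compl]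
      congr 2
      ext x
      simp only [Set.mem_sdiff, mem_inter_iff, mem_compl_iff, mem_ball]
      grind
    rw [hind, ← lintegral_add_left hfm, ← setLIntegral_const]
    refine setLIntegral_mono measurable_const fun x hx => ?_
    have hxr : r ≤ ‖x - y‖ := by
      simpa [dist_eq_norm] using hx.2
    by_cases hxR : x ∈ (ball y R)ᶜ
    · have hxR' : R ≤ ‖x - y‖ := by simpa [dist_eq_norm] using hxR
      rw [indicator_of_mem hxR, hf, hd, ha, ← ENNReal.ofReal_add (by positivity)
        (sub_nonneg.2 (Real.rpow_le_rpow_of_nonpos hr hrR (by linarith)))]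
      refine ENNReal.ofReal_le_ofReal ?_
      have := Real.rpow_le_rpow_of_nonpos (hr.trans_le hrR) hxR' (neg_nonpos.2 hs.le)
      linarith
    · rw [indicator_of_notMem hxR, add_zero]
      exact ENNReal.ofReal_le_ofReal (Real.rpow_le_rpow_of_nonpos hr hxr (neg_nonpos.2 hs.le))
  have hinner : a * volume (ball y r \ E) ≤ ∫⁻ x in ball y r \ E, f x := by
    rw [← setLIntegral_const]
    refine setLIntegral_mono_ae hfm.aemeasurable ?_
    have hne : ∀ᵐ x : Rn n, x ≠ y := by simp [ae_iff]
    filter_upwards [hne] with x hx hxB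
    refine ENNReal.ofReal_le_ofReal
      (Real.rpow_le_rpow_of_nonpos (norm_pos_iff.2 (sub_ne_zero.2 hx)) ?_ (neg_nonpos.2 hs.le))
    exact (mem_ball_iff_norm.1 hxB.1).le
  have hsplitE : rieszAt n s E y =
      (∫⁻ x in E ∩ ball y r, f x) + ∫⁻ x in E \ ball y r, f x :=
    (lintegral_inter_add_sdiff f E hB).symm
  have hsplitB : rieszAt n s (ball y r) y =
      (∫⁻ x in E ∩ ball y r, f x) + ∫⁻ x in ball y r \ E, f x := by
    rw [inter_comm]
    exact (lintegral_inter_add_sdiff f (ball y r) hE).symm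
  rw [hsplitE, hsplitB, add_assoc]
  gcongr
  exact houter.trans (hdiff ▸ hinner)

lemma rieszAt_le_rieszAt_ball {n : ℕ} (hn : n ≠ 0) {s : ℝ} (hs : 0 < s) {E : Set (Rn n)}
    (hE : MeasurableSet E) (hfin : volume E ≠ ⊤) (y : Rn n) :
    rieszAt n s E y ≤ rieszAt n s (ball y (ballRad n E)) y := by
  have hvol := volume_ball_ballRad hn hfin y
  rcases (ballRad_nonneg n E).eq_or_lt with h0 | hpos
  · have : volume E = 0 := by rw [← hvol, ← h0, ball_zero, measure_empty]
    simp [rieszAt, Measure.restrict_eq_zero.2 this]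
  · exact le_self_add.trans (rieszAt_add_mul_volume_diff_le hn hs hE hpos le_rfl hvol)

lemma ballRad_ball {n : ℕ} (hn : n ≠ 0) (c : Rn n) {r : ℝ} (hr : 0 ≤ r) :
    ballRad n (ball c r) = r := by
  have h := unitBallVol_pos n
  rw [ballRad, volume_ball_eq hn c hr, ENNReal.toReal_ofReal (by positivity),
    mul_div_cancel_right₀ _ h.ne', one_div, Real.pow_rpow_inv_natCast hr hn]

lemma Vs_ball {n : ℕ} (hn : n ≠ 0) {s : ℝ} (hs : 0 < s) (hsn : s < n) (c : Rn n) {r : ℝ}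
    (hr : 0 ≤ r) :
    Vs n s (ball c r) =
      ENNReal.ofReal ((n * unitBallVol n / ((n : ℝ) - s)) * r ^ ((n : ℝ) - s)) := by
  refine le_antisymm (iSup_le fun y => ?_) ?_
  · refine (rieszAt_le_rieszAt_ball hn hs measurableSet_ball measure_ball_lt_top.ne y).trans_eq ?_
    rw [ballRad_ball hn c hr, rieszAt_ball_self hn hsn y hr]
  · rw [← rieszAt_ball_self hn hsn c hr]
    exact le_iSup (rieszAt n s (ball c r)) c

/-- Near-maximal potential forces `E` to lie in a slightly enlarged ball, up to small volume. -/
lemma exists_volume_diff_ball_lt {n : ℕ} (hn : n ≠ 0) {s : ℝ} (hs : 0 < s) (hsn : s < n)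
    {E : Set (Rn n)} (hE : MeasurableSet E) {r R : ℝ} (hr : 0 < r) (hrR : r < R)
    (hvol : volume (ball (0 : Rn n) r) = volume E)
    (hV : Vs n s E = Vs n s (ball (0 : Rn n) r)) {ε : ℝ≥0∞} (hε : ε ≠ 0) :
    ∃ y : Rn n, volume (E \ ball y R) < ε := by
  by_contra! hcon
  set d := ENNReal.ofReal (r ^ (-s) - R ^ (-s)) with hd
  have hd0 : d ≠ 0 :=
    (ENNReal.ofReal_pos.2 (sub_pos.2 (Real.rpow_lt_rpow_of_neg hr hrR (neg_neg_of_pos hs)))).ne'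
  have hle : Vs n s E + d * ε ≤ Vs n s (ball (0 : Rn n) r) := by
    rw [Vs, ENNReal.iSup_add]
    refine iSup_le fun y => ?_
    have hy : volume (ball y r) = volume E := by
      rw [← hvol, volume_ball_eq hn _ hr.le, volume_ball_eq hn _ hr.le]
    calc rieszAt n s E y + d * ε ≤ rieszAt n s E y + d * volume (E \ ball y R) := by
          gcongr; exact hcon y
      _ ≤ rieszAt n s (ball y r) y := rieszAt_add_mul_volume_diff_le hn hs hE hr hrR.le hy
      _ = Vs n s (ball (0 : Rn n) r) := by
          rw [rieszAt_ball_self hn hsn y hr.le, Vs_ball hn hs hsn 0 hr.le]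
  rw [hV, Vs_ball hn hs hsn 0 hr.le] at hle
  exact absurd hle (not_le.2 (ENNReal.lt_add_right ENNReal.ofReal_ne_top (mul_ne_zero hd0 hε)))

/-- A set of the volume of an `r`-ball that is almost contained in slightly larger balls is itself
an `r`-ball up to a null set. -/
lemma exists_symmDiff_ball_null {n : ℕ} (hn : n ≠ 0) {E : Set (Rn n)} (hE : MeasurableSet E)
    {r : ℝ} (hr : 0 < r) (hvol : volume (ball (0 : Rn n) r) = volume E)
    (h : ∀ R > r, ∀ ε : ℝ≥0∞, ε ≠ 0 → ∃ y : Rn n, volume (E \ ball y R) < ε) :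
    ∃ c : Rn n, volume (E ∆ ball c r) = 0 := by
  have : NeZero n := ⟨hn⟩
  have hE0 : volume E ≠ 0 := hvol ▸ (measure_ball_pos volume _ hr).ne'
  have hEtop : volume E ≠ ⊤ := hvol ▸ measure_ball_lt_top.ne
  obtain ⟨δ, -, hδpos, hδlim⟩ := exists_seq_strictAnti_tendsto' hr
  obtain ⟨ε, -, hεpos, hεlim⟩ := exists_seq_strictAnti_tendsto' (ENNReal.half_pos hE0)
  choose y hy using fun k => h (r + δ k) (by linarith [(hδpos k).1]) (ε k) (hεpos k).1.ne'
  have hbdd : ∀ k, y k ∈ closedBall (y 0) (4 * r) := by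
    intro k
    by_contra hk
    rw [mem_closedBall, not_le] at hk
    have hdisj : Disjoint (ball (y k) (r + δ k)) (ball (y 0) (r + δ 0)) :=
      ball_disjoint_ball (by linarith [(hδpos k).2, (hδpos 0).2])
    have hcover : E ⊆ (E \ ball (y k) (r + δ k)) ∪ (E \ ball (y 0) (r + δ 0)) := by
      intro x hx
      by_cases hxk : x ∈ ball (y k) (r + δ k)
      · exact Or.inr ⟨hx, disjoint_left.1 hdisj hxk⟩
      · exact Or.inl ⟨hx, hxk⟩
    have : volume E < volume E := calc
      volume E ≤ volume (E \ ball (y k) (r + δ k)) + volume (E \ ball (y 0) (r + δ 0)) :=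
        (measure_mono hcover).trans (measure_union_le _ _)
      _ < volume E / 2 + volume E / 2 :=
        ENNReal.add_lt_add ((hy k).trans (hεpos k).2) ((hy 0).trans (hεpos 0).2)
      _ = volume E := ENNReal.add_halves _
    exact this.false
  obtain ⟨c, -, φ, hφ, hlim⟩ := tendsto_subseq_of_bounded isBounded_closedBall hbdd
  refine ⟨c, ?_⟩
  have hout : ∀ R > r, volume (E \ ball c R) = 0 := by
    intro R hR
    have hrad : Tendsto (fun k => r + δ (φ k) + dist (y (φ k)) c) atTop (𝓝 r) := by
      simpa using ((hδlim.comp hφ.tendsto_atTop).const_add r).add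
        (tendsto_iff_dist_tendsto_zero.1 hlim)
    refine le_antisymm (ge_of_tendsto (hεlim.comp hφ.tendsto_atTop) ?_) zero_le
    filter_upwards [hrad.eventually_lt_const hR] with k hk
    refine (measure_mono (sdiff_subset_sdiff_right ?_)).trans (hy (φ k)).le
    exact ball_subset_ball' hk.le
  have hclosed : volume (E \ closedBall c r) = 0 := by
    obtain ⟨u, -, hu, hulim⟩ := exists_seq_strictAnti_tendsto r
    refine measure_mono_null ?_ (measure_iUnion_null fun k => hout (u k) (hu k))
    rintro x ⟨hxE, hx⟩
    rw [mem_closedBall, not_le] at hx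
    obtain ⟨k, hk⟩ := (hulim.eventually_lt_const hx).exists
    exact mem_iUnion.2 ⟨k, hxE, fun hxk => (mem_ball.1 hxk).not_gt hk⟩
  have hball : volume (E \ ball c r) = 0 := by
    refine measure_mono_null (t := (E \ closedBall c r) ∪ sphere c r) ?_
      (measure_union_null hclosed (Measure.addHaar_sphere volume c r))
    rintro x ⟨hxE, hx⟩
    rw [mem_ball, not_lt] at hx
    rcases hx.eq_or_lt with hx | hx
    · exact Or.inr hx.symm
    · exact Or.inl ⟨hxE, fun hxc => (mem_closedBall.1 hxc).not_gt hx⟩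
  have hc : volume E = volume (ball c r) := by
    rw [← hvol, volume_ball_eq hn _ hr.le, volume_ball_eq hn _ hr.le]
  have hball' : volume (ball c r \ E) = 0 := by
    rw [← measure_sdiff_symm hE.nullMeasurableSet measurableSet_ball.nullMeasurableSet hc
      (measure_ne_top_of_subset inter_subset_left hEtop), hball]
  exact measure_union_null hball hball'

/-- **`V_s` is maximized by balls.** For every measurable set `E ⊆ ℝⁿ` of finite measure one has
`V_s(E) ≤ V_s(E*) = (n ω_n^{s/n}/(n-s)) |E|^{(n-s)/n}`, where `E*` is the ball centered at the
origin with `|E*| = |E|`; equality holds only if `E` is (equivalent to) a ball. In particular,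
`V_s(B_r) = (n ω_n/(n-s)) r^{n-s}` for every ball of radius `r ≥ 0`. -/
theorem stmt_6 (n : ℕ) (hn : 2 ≤ n) (s : ℝ) (hs : s ∈ Set.Ioo (0 : ℝ) 1) :
    (∀ E : Set (Rn n), MeasurableSet E → volume E ≠ ⊤ →
      Vs n s E ≤ Vs n s (ball (0 : Rn n) (ballRad n E)) ∧
      Vs n s (ball (0 : Rn n) (ballRad n E)) =
        ENNReal.ofReal ((n * unitBallVol n ^ (s / n) / ((n : ℝ) - s)) *
          (volume E).toReal ^ (((n : ℝ) - s) / n)) ∧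
      (Vs n s E = Vs n s (ball (0 : Rn n) (ballRad n E)) →
        ∃ (c : Rn n) (r : ℝ), volume (E ∆ ball c r) = 0)) ∧
    ∀ (c : Rn n) (r : ℝ), 0 ≤ r →
      Vs n s (ball c r) =
        ENNReal.ofReal ((n * unitBallVol n / ((n : ℝ) - s)) * r ^ ((n : ℝ) - s)) := by
  obtain ⟨hs0, hs1⟩ := hs
  have hn0 : n ≠ 0 := by omega
  have hsn : s < n := hs1.trans (by exact_mod_cast hn)
  refine ⟨fun E hE hfin => ⟨iSup_le fun y => ?_, ?_, fun hV => ?_⟩,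
    fun c r hr => Vs_ball hn0 hs0 hsn c hr⟩
  · refine (rieszAt_le_rieszAt_ball hn0 hs0 hE hfin y).trans_eq ?_
    rw [rieszAt_ball_self hn0 hsn y (ballRad_nonneg n E),
      Vs_ball hn0 hs0 hsn 0 (ballRad_nonneg n E)]
  · have hω := unitBallVol_pos n
    have hn' : (n : ℝ) ≠ 0 := by exact_mod_cast hn0
    rw [Vs_ball hn0 hs0 hsn 0 (ballRad_nonneg n E), ballRad, ← Real.rpow_mul (by positivity),
      one_div_mul_eq_div, Real.div_rpow ENNReal.toReal_nonneg hω.le]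
    have hpow : unitBallVol n = unitBallVol n ^ (s / n) * unitBallVol n ^ (((n : ℝ) - s) / n) := by
      rw [← Real.rpow_add hω, ← add_div, add_sub_cancel, div_self hn', Real.rpow_one]
    congr 1
    nth_rewrite 1 [hpow]
    have := (Real.rpow_pos_of_pos hω (((n : ℝ) - s) / n)).ne'
    field_simp
  · have hvol := volume_ball_ballRad hn0 hfin (0 : Rn n)
    rcases (ballRad_nonneg n E).eq_or_lt with h0 | hpos
    · refine ⟨0, 0, ?_⟩
      rw [ball_zero, ← bot_eq_empty, symmDiff_bot, ← hvol, ← h0, ball_zero, measure_empty]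
    · obtain ⟨c, hc⟩ := exists_symmDiff_ball_null hn0 hE hpos hvol fun R hR ε hε =>
        exists_volume_diff_ball_lt hn0 hs0 hsn hE hpos hR hvol hV hε
      exact ⟨c, _, hc⟩
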